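/- arXiv:1802.08933 — 2 statements merged into one kernel-verified Lean document; each statement's English description precedes it below -/
import Mathlib

section
/- Let (a_n)_{n≥0} be a real sequence with (1/(n+1))·∑_{i=0}^n a_i → a. Let j : ℕ → ℕ satisfy j(m)/m → k for some k > 0, and let c > 0. Then (1/(m+1))·∑_{i=j(m)}^{j(m)+⌊c·m⌋} a_i → c·a as m → ∞. -/
open Filter

theorem aux_comp (a : ℕ → ℝ) (A : ℝ)
    (ha : Tendsto (fun n => (∑ i ∈ Finset.range (n + 1), a i) / (n + 1)) atTop (nhds A))
    (u : ℕ → ℕ) (L : ℝ) (hL : 0 < L)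
    (hu : Tendsto (fun m : ℕ => (u m : ℝ) / (m + 1)) atTop (nhds L)) :
    Tendsto (fun m : ℕ => (∑ i ∈ Finset.range (u m), a i) / ((m : ℝ) + 1))
      atTop (nhds (A * L)) := by
  have hS : Tendsto (fun n : ℕ => (∑ i ∈ Finset.range n, a i) / (n : ℝ)) atTop (nhds A) := by
    rw [← tendsto_add_atTop_iff_nat 1]
    simpa using ha
  have hm : Tendsto (fun m : ℕ => (m : ℝ) + 1) atTop atTop :=
    tendsto_atTop_add_const_right _ _ tendsto_natCast_atTop_atTop
  have hinf : Tendsto u atTop atTop := by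
    rw [← tendsto_natCast_atTop_iff (R := ℝ)]
    refine (hu.pos_mul_atTop hL hm).congr fun m => ?_
    have : (m : ℝ) + 1 ≠ 0 := by positivity
    field_simp
  refine ((hS.comp hinf).mul hu).congr fun m => ?_
  have : (m : ℝ) + 1 ≠ 0 := by positivity
  simp only [Function.comp]
  rcases Nat.eq_zero_or_pos (u m) with h | h
  · simp [h]
  · have h' : (u m : ℝ) ≠ 0 := by positivity
    field_simp

theorem stmt_4 (a : ℕ → ℝ) (A : ℝ)
    (ha : Tendsto (fun n => (∑ i ∈ Finset.range (n + 1), a i) / (n + 1)) atTop (nhds A))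
    (j : ℕ → ℕ) (k : ℝ) (hk : 0 < k)
    (hj : Tendsto (fun m => (j m : ℝ) / m) atTop (nhds k))
    (c : ℝ) (hc : 0 < c) :
    Tendsto (fun m => (∑ i ∈ Finset.Icc (j m) (j m + ⌊c * m⌋₊), a i) / (m + 1))
      atTop (nhds (c * A)) := by
  have h1 : Tendsto (fun m : ℕ => (m : ℝ) / (m + 1)) atTop (nhds 1) :=
    tendsto_natCast_div_add_atTop (1 : ℝ)
  have h0 : Tendsto (fun m : ℕ => 1 / ((m : ℝ) + 1)) atTop (nhds 0) :=
    tendsto_one_div_add_atTop_nhds_zero_nat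
  have hf : Tendsto (fun m : ℕ => (⌊c * m⌋₊ : ℝ) / m) atTop (nhds c) :=
    (tendsto_nat_floor_mul_div_atTop hc.le).comp tendsto_natCast_atTop_atTop
  have key : ∀ (v : ℕ → ℝ) (l : ℝ), Tendsto (fun m : ℕ => v m / m) atTop (nhds l) →
      Tendsto (fun m : ℕ => v m / ((m : ℝ) + 1)) atTop (nhds l) := by
    intro v l hv
    have h := hv.mul h1
    rw [mul_one] at h
    refine h.congr' ?_
    filter_upwards [eventually_gt_atTop 0] with m hm
    have : (m : ℝ) ≠ 0 := by positivity
    have : (m : ℝ) + 1 ≠ 0 := by positivity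
    field_simp
  have hj' := key _ _ hj
  have hf' := key _ _ hf
  have hu : Tendsto (fun m : ℕ => ((j m + ⌊c * m⌋₊ + 1 : ℕ) : ℝ) / (m + 1)) atTop
      (nhds (k + c)) := by
    have h := (hj'.add hf').add h0
    rw [add_zero] at h
    refine h.congr fun m => ?_
    push_cast
    ring
  have H := (aux_comp a A ha _ _ (by positivity) hu).sub (aux_comp a A ha j k hk hj')
  have e : A * (k + c) - A * k = c * A := by ring
  rw [e] at H
  refine H.congr fun m => ?_
  rw [← sub_div, ← Finset.sum_Ico_eq_sub a (by omega)]
  rfl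
end

section
/- Let g_n : ℕ → ℝ be defined by a subadditive sequence: suppose f_{n+m}(U) ≤ f_n(U) + f_m(τⁿU) for a measure-preserving transformation τ of a probability space, with f_n ∈ L¹ and f_n ≥ 0. Then f_n/n converges almost surely and in L¹ to an integrable limit. -/
open MeasureTheory Filter

theorem integral_comp_mp {Ω : Type*} [MeasurableSpace Ω] {μ : Measure Ω}
    {τ : Ω → Ω} (hτ : MeasurePreserving τ μ μ) {g : Ω → ℝ} (hg : Integrable g μ) :
    ∫ ω, g (τ ω) ∂μ = ∫ ω, g ω ∂μ := by
  have h := integral_map (μ := μ) (φ := τ) hτ.measurable.aemeasurable (f := g)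
    (by rw [hτ.map_eq]; exact hg.aestronglyMeasurable)
  rw [hτ.map_eq] at h
  exact h.symm

theorem integrable_comp_mp {Ω : Type*} [MeasurableSpace Ω] {μ : Measure Ω}
    {τ : Ω → Ω} (hτ : MeasurePreserving τ μ μ) {g : Ω → ℝ} (hg : Integrable g μ) :
    Integrable (fun ω => g (τ ω)) μ :=
  (hτ.integrable_comp hg.aestronglyMeasurable).2 hg

/-- Running maximum of the Birkhoff sums of `g`. -/
noncomputable def runMax {Ω : Type*} (τ : Ω → Ω) (g : Ω → ℝ) : ℕ → Ω → ℝ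
  | 0 => fun _ => 0
  | n + 1 => fun ω => max 0 (g ω + runMax τ g n (τ ω))

theorem runMax_nonneg {Ω : Type*} (τ : Ω → Ω) (g : Ω → ℝ) (n : ℕ) (ω : Ω) :
    0 ≤ runMax τ g n ω := by
  cases n with
  | zero => exact le_rfl
  | succ n => exact le_max_left _ _

theorem runMax_mono {Ω : Type*} (τ : Ω → Ω) (g : Ω → ℝ) (n : ℕ) :
    ∀ ω, runMax τ g n ω ≤ runMax τ g (n + 1) ω := by
  induction n with
  | zero => intro ω; exact runMax_nonneg τ g 1 ω
  | succ n ih =>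
    intro ω
    exact max_le_max le_rfl (by have := ih (τ ω); linarith)

theorem runMax_integrable {Ω : Type*} [MeasurableSpace Ω] {μ : Measure Ω}
    {τ : Ω → Ω} (hτ : MeasurePreserving τ μ μ) {g : Ω → ℝ} (hg : Integrable g μ) (n : ℕ) :
    Integrable (runMax τ g n) μ := by
  induction n with
  | zero => exact integrable_zero _ _ _
  | succ n ih => exact (integrable_zero _ _ _).sup (hg.add (integrable_comp_mp hτ ih))

theorem birkhoffSum_le_runMax {Ω : Type*} (τ : Ω → Ω) (h : Ω → ℝ) (δ : ℝ) (n : ℕ) :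
    ∀ ω, birkhoffSum τ h n ω - δ * n ≤ runMax τ (fun ω => h ω - δ) n ω := by
  induction n with
  | zero => intro ω; simp [runMax]
  | succ n ih =>
    intro ω
    refine le_trans ?_ (le_max_right _ _)
    rw [birkhoffSum_succ']
    have := ih (τ ω)
    push_cast
    linarith

/-- Maximal ergodic inequality. -/
theorem maximal_ineq {Ω : Type*} [MeasurableSpace Ω] {μ : Measure Ω} [IsProbabilityMeasure μ]
    {τ : Ω → Ω} (hτ : MeasurePreserving τ μ μ) {h : Ω → ℝ} (hh : Integrable h μ)
    (h0 : ∀ ω, 0 ≤ h ω) {δ : ℝ} (hδ : 0 < δ) :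
    μ {ω | ∃ n : ℕ, δ * n < birkhoffSum τ h n ω} ≤ ENNReal.ofReal ((∫ ω, h ω ∂μ) / δ) := by
  set M := runMax τ (fun ω => h ω - δ) with hM
  have hMi : ∀ n, Integrable (M n) μ := fun n =>
    runMax_integrable hτ (hh.sub (integrable_const δ)) n
  have hmono : Monotone fun n => {ω | 0 < M n ω} := by
    refine monotone_nat_of_le_succ fun n ω hω => ?_
    exact lt_of_lt_of_le hω (runMax_mono _ _ _ _)
  have hsubset : {ω | ∃ n : ℕ, δ * n < birkhoffSum τ h n ω} ⊆ ⋃ n, {ω | 0 < M n ω} := by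
    rintro ω ⟨n, hn⟩
    refine Set.mem_iUnion.2 ⟨n, ?_⟩
    have := birkhoffSum_le_runMax τ h δ n ω
    show 0 < M n ω
    rw [hM]; linarith
  refine (measure_mono hsubset).trans ?_
  rw [hmono.measure_iUnion]
  refine iSup_le fun n => ?_
  have hA : NullMeasurableSet {ω | 0 < M n ω} μ :=
    nullMeasurableSet_lt aemeasurable_const (hMi n).aemeasurable
  have hpt : ∀ ω, M n ω + {ω | 0 < M n ω}.indicator (fun _ => δ) ω ≤ h ω + M n (τ ω) := by
    intro ω
    by_cases hω : 0 < M n ω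
    · rw [Set.indicator_of_mem (by exact hω)]
      cases n with
      | zero => exact absurd hω (lt_irrefl _)
      | succ n =>
        have h1 : M (n + 1) ω = max 0 (h ω - δ + M n (τ ω)) := rfl
        have h2 : M n (τ ω) ≤ M (n + 1) (τ ω) := runMax_mono _ _ _ _
        rw [h1] at hω ⊢
        rcases max_choice 0 (h ω - δ + M n (τ ω)) with h3 | h3
        · rw [h3] at hω; exact absurd hω (lt_irrefl _)
        · rw [h3]; linarith
    · rw [Set.indicator_of_notMem (by exact hω)]
      have h1 := h0 ω
      have h2 : 0 ≤ M n (τ ω) := runMax_nonneg _ _ _ _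
      linarith
  have hI : Integrable ({ω | 0 < M n ω}.indicator (fun _ => δ)) μ :=
    (integrable_const δ).indicator₀ hA
  have hint := integral_mono ((hMi n).add hI) (hh.add (integrable_comp_mp hτ (hMi n))) hpt
  simp only [Pi.add_apply] at hint
  rw [integral_add (hMi n) hI, integral_add hh (integrable_comp_mp hτ (hMi n)),
    integral_comp_mp hτ (hMi n), integral_indicator₀ hA, setIntegral_const] at hint
  rw [← ofReal_measureReal (μ := μ)]
  refine ENNReal.ofReal_le_ofReal ?_
  rw [le_div_iff₀ hδ]
  simp only [smul_eq_mul] at hint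
  linarith

/-- Deterministic covering estimate. -/
theorem covering (a : ℕ → ℕ → ℝ) (h : ℕ → ℝ) (c : ℝ) (N : ℕ) (hN : 1 ≤ N)
    (hsub : ∀ k n m, a k (n + m) ≤ a k n + a (k + n) m)
    (hpos : ∀ k n, 0 ≤ a k n) (hh : ∀ k, 0 ≤ h k) (hc : 0 ≤ c)
    (hcov : ∀ k, (∃ n, 1 ≤ n ∧ n ≤ N ∧ a k n ≤ n * c) ∨ a k 1 ≤ h k) (d : ℕ) :
    ∀ k, 1 ≤ d → a k d ≤ d * c + ∑ i ∈ Finset.Ico k (k + d), h i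
      + ∑ i ∈ Finset.Ico (k + d - N) (k + d), a i 1 := by
  induction d using Nat.strong_induction_on with
  | _ d ih =>
  intro k hd
  have hsumh : ∀ p q, 0 ≤ ∑ i ∈ Finset.Ico p q, h i := fun p q => Finset.sum_nonneg fun i _ => hh i
  by_cases hdN : d ≤ N
  · have h1 : ∀ d, 1 ≤ d → a k d ≤ ∑ i ∈ Finset.Ico k (k + d), a i 1 := by
      intro d hd
      induction d, hd using Nat.le_induction with
      | base => simp
      | succ d hd ih2 =>
        rw [← add_assoc, Finset.sum_Ico_succ_top (by omega)]
        have := hsub k d 1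
        linarith
    have h2 : ∑ i ∈ Finset.Ico k (k + d), a i 1 ≤ ∑ i ∈ Finset.Ico (k + d - N) (k + d), a i 1 :=
      Finset.sum_le_sum_of_subset_of_nonneg
        (Finset.Ico_subset_Ico (by omega) le_rfl) (fun i _ _ => hpos i 1)
    have h3 := h1 d hd
    have h4 := hsumh k (k + d)
    have h5 : 0 ≤ (d : ℝ) * c := by positivity
    linarith
  · obtain ⟨n, hn1, hnN, hn⟩ : ∃ n, 1 ≤ n ∧ n ≤ N ∧
        a k n ≤ n * c + ∑ i ∈ Finset.Ico k (k + n), h i := by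
      rcases hcov k with ⟨n, h1, h2, h3⟩ | h1
      · exact ⟨n, h1, h2, by have := hsumh k (k + n); linarith⟩
      · refine ⟨1, le_rfl, hN, ?_⟩
        simp
        linarith
    obtain ⟨m, rfl⟩ : ∃ m, d = n + m := ⟨d - n, by omega⟩
    have h1 := ih m (by omega) (k + n) (by omega)
    have h2 := hsub k n m
    rw [← Finset.sum_Ico_consecutive h (show k ≤ k + n by omega)
      (show k + n ≤ k + (n + m) by omega)]
    rw [show k + n + m = k + (n + m) by omega] at h1
    push_cast
    linarith

theorem exists_liminf {Ω : Type*} [MeasurableSpace Ω] (μ : Measure Ω) [IsProbabilityMeasure μ]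
    (τ : Ω → Ω) (hτ : MeasurePreserving τ μ μ)
    (f : ℕ → Ω → ℝ)
    (hint : ∀ n, Integrable (f n) μ)
    (hpos : ∀ n ω, 0 ≤ f n ω)
    (hsub : ∀ n m ω, f (n + m) ω ≤ f n ω + f m (τ^[n] ω)) :
    ∃ F : Ω → ℝ, Integrable F μ ∧ (∀ ω, 0 ≤ F ω) ∧
      (∀ᵐ ω ∂μ, ∀ k, F (τ^[k] ω) = F ω) ∧
      (∀ᵐ ω ∂μ, ∀ ε > 0, ∀ᶠ n : ℕ in atTop, F ω - ε < f n ω / n) ∧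
      (∀ᵐ ω ∂μ, ∀ ε > 0, ∃ n : ℕ, 1 ≤ n ∧ f n ω ≤ n * (F ω + ε)) := by
  set u : ℕ → Ω → ENNReal := fun n ω => ENNReal.ofReal (f n ω / n) with hu
  set E : Ω → ENNReal := fun ω => liminf (fun n => u n ω) atTop with hE
  have hum : ∀ n, AEMeasurable (u n) μ := fun n =>
    ((hint n).aemeasurable.div_const _).ennreal_ofReal
  have hEm : AEMeasurable E μ := by
    refine ⟨fun ω => liminf (fun n => (hum n).mk (u n) ω) atTop,
      Measurable.liminf fun n => (hum n).measurable_mk, ?_⟩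
    filter_upwards [ae_all_iff.2 fun n => (hum n).ae_eq_mk] with ω hω
    simp only [hE, hω]
  have hint_le : ∀ n, 1 ≤ n → ∫ ω, f n ω ∂μ ≤ n * ∫ ω, f 1 ω ∂μ := by
    intro n hn
    induction n, hn using Nat.le_induction with
    | base => simp
    | succ n hn ih =>
      have h1 := integrable_comp_mp (hτ.iterate n) (hint 1)
      have h2 := integral_mono (hint (n + 1)) ((hint n).add h1) (fun ω => hsub n 1 ω)
      simp only [Pi.add_apply] at h2
      rw [integral_add (hint n) h1, integral_comp_mp (hτ.iterate n) (hint 1)] at h2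
      push_cast
      linarith
  have hEfin : ∫⁻ ω, E ω ∂μ ≠ ⊤ := by
    have h1 : ∫⁻ ω, E ω ∂μ ≤ liminf (fun n => ∫⁻ ω, u n ω ∂μ) atTop := lintegral_liminf_le' hum
    have h2 : liminf (fun n => ∫⁻ ω, u n ω ∂μ) atTop ≤ ENNReal.ofReal (∫ ω, f 1 ω ∂μ) := by
      refine liminf_le_of_frequently_le' (Eventually.frequently ?_)
      filter_upwards [eventually_ge_atTop 1] with n hn
      have hn' : (0 : ℝ) < n := by exact_mod_cast hn
      rw [← ofReal_integral_eq_lintegral_ofReal ((hint n).div_const _)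
        (Eventually.of_forall fun ω => div_nonneg (hpos n ω) hn'.le)]
      refine ENNReal.ofReal_le_ofReal ?_
      rw [integral_div, div_le_iff₀ hn']
      have := hint_le n hn
      linarith
    exact ne_top_of_le_ne_top ENNReal.ofReal_ne_top (h1.trans h2)
  have hEle : ∀ ω, E ω ≤ E (τ ω) := by
    intro ω
    have h1 : Tendsto (fun n : ℕ => ENNReal.ofReal (f 1 ω / ((n : ℝ) + 1))) atTop (nhds 0) := by
      rw [← ENNReal.ofReal_zero]
      refine ENNReal.tendsto_ofReal ?_
      have := tendsto_one_div_add_atTop_nhds_zero_nat (𝕜 := ℝ) |>.const_mul (f 1 ω)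
      simpa [div_eq_mul_inv] using this
    have h2 := ENNReal.liminf_add_of_left_tendsto_zero h1 (fun n => u n (τ ω))
    show liminf (fun n => u n ω) atTop ≤ liminf (fun n => u n (τ ω)) atTop
    rw [← h2, ← liminf_nat_add (fun n => u n ω) 1]
    refine liminf_le_liminf ?_
    filter_upwards [eventually_ge_atTop 1] with n hn
    have hn' : (0 : ℝ) < n := by exact_mod_cast hn
    simp only [hu, Pi.add_apply]
    rw [← ENNReal.ofReal_add (div_nonneg (hpos _ _) (by positivity))
      (div_nonneg (hpos _ _) (by positivity))]
    refine ENNReal.ofReal_le_ofReal ?_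
    have h3 := hsub 1 n ω
    rw [add_comm 1 n] at h3
    push_cast
    have h4 : f n (τ ω) / ((n : ℝ) + 1) ≤ f n (τ ω) / n :=
      div_le_div_of_nonneg_left (hpos _ _) hn' (by linarith)
    have h5 : f (n + 1) ω / ((n : ℝ) + 1) ≤ (f 1 ω + f n (τ ω)) / ((n : ℝ) + 1) :=
      div_le_div_of_nonneg_right h3 (by positivity)
    rw [add_div] at h5
    linarith
  have hEcomp : ∫⁻ ω, E (τ ω) ∂μ = ∫⁻ ω, E ω ∂μ := by
    have h := lintegral_map' (μ := μ) (f := E) (g := τ) (by rw [hτ.map_eq]; exact hEm)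
      hτ.measurable.aemeasurable
    rw [hτ.map_eq] at h
    exact h.symm
  have hEinv : E =ᵐ[μ] fun ω => E (τ ω) :=
    ae_eq_of_ae_le_of_lintegral_le (Eventually.of_forall hEle) hEfin
      (hEm.comp_quasiMeasurePreserving hτ.quasiMeasurePreserving) hEcomp.le
  have hEtop : ∀ᵐ ω ∂μ, E ω < ⊤ := ae_lt_top' hEm hEfin
  refine ⟨fun ω => (E ω).toReal, integrable_toReal_of_lintegral_ne_top hEm hEfin,
    fun ω => ENNReal.toReal_nonneg, ?_, ?_, ?_⟩
  · have : ∀ k, ∀ᵐ ω ∂μ, E (τ^[k] ω) = E (τ (τ^[k] ω)) := fun k =>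
      (hτ.iterate k).quasiMeasurePreserving.ae hEinv
    filter_upwards [ae_all_iff.2 this] with ω hω k
    congr 1
    induction k with
    | zero => rfl
    | succ k ih => rw [Function.iterate_succ_apply', ← hω k, ih]
  · filter_upwards [hEtop] with ω hω ε hε
    by_cases h0 : (E ω).toReal - ε < 0
    · filter_upwards with n
      exact lt_of_lt_of_le h0 (div_nonneg (hpos n ω) n.cast_nonneg)
    · have h1 : ENNReal.ofReal ((E ω).toReal - ε) < E ω := by
        rw [ENNReal.ofReal_lt_iff_lt_toReal (not_lt.1 h0) hω.ne]
        linarith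
      filter_upwards [eventually_lt_of_lt_liminf h1] with n hn
      exact (ENNReal.ofReal_lt_ofReal_iff_of_nonneg (not_lt.1 h0)).1 hn
  · filter_upwards [hEtop] with ω hω ε hε
    have h1 : E ω < ENNReal.ofReal ((E ω).toReal + ε) := by
      rw [ENNReal.lt_ofReal_iff_toReal_lt hω.ne]
      linarith
    have h2 := frequently_lt_of_liminf_lt (by isBoundedDefault) h1
    obtain ⟨n, hn, hn1⟩ := (h2.and_eventually (eventually_ge_atTop 1)).exists
    refine ⟨n, hn1, ?_⟩
    have hn' : (0 : ℝ) < n := by exact_mod_cast hn1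
    have h3 := (ENNReal.ofReal_lt_ofReal_iff_of_nonneg (div_nonneg (hpos n ω) hn'.le)).1 hn
    rw [div_lt_iff₀ hn'] at h3
    linarith

theorem key {Ω : Type*} [MeasurableSpace Ω] (μ : Measure Ω) [IsProbabilityMeasure μ]
    (τ : Ω → Ω) (hτ : MeasurePreserving τ μ μ)
    (f : ℕ → Ω → ℝ)
    (hint : ∀ n, Integrable (f n) μ)
    (hpos : ∀ n ω, 0 ≤ f n ω)
    (hsub : ∀ n m ω, f (n + m) ω ≤ f n ω + f m (τ^[n] ω))
    (F : Ω → ℝ) (hF : Integrable F μ) (hF0 : ∀ ω, 0 ≤ F ω)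
    (hinv : ∀ᵐ ω ∂μ, ∀ k, F (τ^[k] ω) = F ω)
    (hex : ∀ᵐ ω ∂μ, ∀ ε > 0, ∃ n : ℕ, 1 ≤ n ∧ f n ω ≤ n * (F ω + ε))
    (ε η : ℝ) (hε : 0 < ε) (hη : 0 < η) :
    ∃ (C : ℝ) (h : Ω → ℝ), 0 ≤ C ∧ Integrable h μ ∧ (∀ ω, 0 ≤ h ω) ∧ ∫ ω, h ω ∂μ < η ∧
      ∀ᵐ ω ∂μ, ∀ L : ℕ, 1 ≤ L → f L ω ≤ L * (F ω + ε) + C + birkhoffSum τ h L ω := by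
  set B : ℕ → Set Ω := fun N => {ω | ∀ n : ℕ, 1 ≤ n → n ≤ N → n * (F ω + ε) < f n ω} with hB
  have hBm : ∀ N, NullMeasurableSet (B N) μ := by
    intro N
    have : B N = ⋂ n : ℕ, ⋂ (_ : 1 ≤ n), ⋂ (_ : n ≤ N), {ω | n * (F ω + ε) < f n ω} := by
      ext ω; simp [hB]
    rw [this]
    refine NullMeasurableSet.iInter fun n => NullMeasurableSet.iInter fun _ =>
      NullMeasurableSet.iInter fun _ => ?_
    exact nullMeasurableSet_lt ((hF.aemeasurable.add_const ε).const_mul _) (hint n).aemeasurable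
  have hlim1 : Tendsto (fun N => ∫ ω, (B N).indicator (f 1) ω ∂μ) atTop (nhds 0) := by
    rw [show nhds (0 : ℝ) = nhds (∫ _ : Ω, (0 : ℝ) ∂μ) by rw [integral_zero]]
    refine tendsto_integral_of_dominated_convergence (f 1)
      (fun N => ((hint 1).indicator₀ (hBm N)).aestronglyMeasurable) (hint 1) ?_ ?_
    · refine fun N => Eventually.of_forall fun ω => ?_
      rw [Real.norm_of_nonneg (Set.indicator_nonneg (fun ω _ => hpos 1 ω) ω)]
      exact Set.indicator_le_self' (fun ω _ => hpos 1 ω) ω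
    · filter_upwards [hex] with ω hω
      obtain ⟨n, hn1, hn⟩ := hω ε hε
      refine tendsto_const_nhds.congr' ?_
      filter_upwards [eventually_ge_atTop n] with N hN
      rw [Set.indicator_of_notMem]
      intro hmem
      exact absurd hn (not_le.2 (hmem n hn1 hN))
  have hti : ∀ K : ℕ, Integrable (fun ω => max 0 (f 1 ω - K)) μ := fun K =>
    (integrable_zero _ _ _).sup ((hint 1).sub (integrable_const _))
  have hlim2 : Tendsto (fun K : ℕ => ∫ ω, max 0 (f 1 ω - K) ∂μ) atTop (nhds 0) := by
    rw [show nhds (0 : ℝ) = nhds (∫ _ : Ω, (0 : ℝ) ∂μ) by rw [integral_zero]]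
    refine tendsto_integral_of_dominated_convergence (f 1)
      (fun N => (hti N).aestronglyMeasurable) (hint 1) ?_ ?_
    · refine fun N => Eventually.of_forall fun ω => ?_
      rw [Real.norm_of_nonneg (le_max_left _ _)]
      exact max_le (hpos 1 ω) (by linarith [N.cast_nonneg (α := ℝ)])
    · refine Eventually.of_forall fun ω => ?_
      refine tendsto_const_nhds.congr' ?_
      filter_upwards [eventually_ge_atTop ⌈f 1 ω⌉₊] with N hN
      have := Nat.ceil_le.1 hN
      rw [max_eq_left (by linarith)]
  obtain ⟨N, hN, hN1⟩ := ((hlim1.eventually_lt_const (half_pos hη)).and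
    (eventually_ge_atTop 1)).exists
  obtain ⟨K, hK⟩ := (hlim2.eventually_lt_const (half_pos hη)).exists
  have hI1 := (hint 1).indicator₀ (hBm N)
  have hind0 : ∀ ω, 0 ≤ (B N).indicator (f 1) ω := fun ω =>
    Set.indicator_nonneg (fun ω _ => hpos 1 ω) ω
  refine ⟨N * K, fun ω => (B N).indicator (f 1) ω + max 0 (f 1 ω - K), by positivity,
    hI1.add (hti K), fun ω => add_nonneg (hind0 ω) (le_max_left _ _), ?_, ?_⟩
  · rw [integral_add hI1 (hti K)]; linarith
  filter_upwards [hinv] with ω hω L hL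
  have hc := covering (fun k n => f n (τ^[k] ω)) (fun k => (B N).indicator (f 1) (τ^[k] ω))
    (F ω + ε) N hN1 ?_ (fun k n => hpos _ _) (fun k => hind0 _) (by linarith [hF0 ω]) ?_ L 0 hL
  · simp only [zero_add, Function.iterate_zero, id_eq, Nat.Ico_zero_eq_range] at hc
    have h1 : ∑ i ∈ Finset.Ico (L - N) L, f 1 (τ^[i] ω)
        ≤ N * K + ∑ i ∈ Finset.range L, max 0 (f 1 (τ^[i] ω) - K) := by
      calc ∑ i ∈ Finset.Ico (L - N) L, f 1 (τ^[i] ω)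
          ≤ ∑ i ∈ Finset.Ico (L - N) L, ((K : ℝ) + max 0 (f 1 (τ^[i] ω) - K)) :=
            Finset.sum_le_sum fun i _ => by
              have := le_max_right 0 (f 1 (τ^[i] ω) - K); linarith
        _ = ((L - (L - N) : ℕ) : ℝ) * K
            + ∑ i ∈ Finset.Ico (L - N) L, max 0 (f 1 (τ^[i] ω) - K) := by
            rw [Finset.sum_add_distrib]; simp
        _ ≤ _ := by
          refine add_le_add (mul_le_mul_of_nonneg_right ?_ K.cast_nonneg) ?_
          · exact_mod_cast (by omega : L - (L - N) ≤ N)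
          · refine Finset.sum_le_sum_of_subset_of_nonneg ?_ (fun i _ _ => le_max_left _ _)
            intro i hi
            simp only [Finset.mem_Ico, Finset.mem_range] at hi ⊢
            omega
    simp only [birkhoffSum, Finset.sum_add_distrib]
    linarith
  · intro k n m
    have := hsub n m (τ^[k] ω)
    rwa [← Function.iterate_add_apply, add_comm n k] at this
  · intro k
    by_cases hk : τ^[k] ω ∈ B N
    · right
      simp only [Set.indicator_of_mem hk, le_refl]
    · left
      simp only [hB, Set.mem_ofPred_eq, not_forall, not_lt] at hk
      obtain ⟨n, h1, h2, h3⟩ := hk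
      rw [hω k] at h3
      exact ⟨n, h1, h2, h3⟩

theorem stmt_14 {Ω : Type*} [MeasurableSpace Ω] (μ : Measure Ω) [IsProbabilityMeasure μ]
    (τ : Ω → Ω) (hτ : MeasurePreserving τ μ μ)
    (f : ℕ → Ω → ℝ)
    (hint : ∀ n, Integrable (f n) μ)
    (hpos : ∀ n ω, 0 ≤ f n ω)
    (hsub : ∀ n m ω, f (n + m) ω ≤ f n ω + f m (τ^[n] ω)) :
    ∃ F : Ω → ℝ, Integrable F μ ∧
      (∀ᵐ ω ∂μ, Tendsto (fun n => f n ω / n) atTop (nhds (F ω))) ∧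
      Tendsto (fun n => ∫ ω, |f n ω / n - F ω| ∂μ) atTop (nhds 0) := by
  obtain ⟨F, hF, hF0, hinv, hlow, hex⟩ := exists_liminf μ τ hτ f hint hpos hsub
  have hkey := key μ τ hτ f hint hpos hsub F hF hF0 hinv hex
  have hup : ∀ δ : ℝ, 0 < δ → ∀ᵐ ω ∂μ, ∀ᶠ n : ℕ in atTop, f n ω / n ≤ F ω + δ := by
    intro δ hδ
    rw [ae_iff]
    have hδ3 : 0 < δ / 3 := by positivity
    have hle : ∀ η : ℝ, 0 < η → μ {ω | ¬ ∀ᶠ n : ℕ in atTop, f n ω / n ≤ F ω + δ}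
        ≤ ENNReal.ofReal (η / (δ / 3)) := by
      intro η hη
      obtain ⟨C, h, hC, hhi, hh0, hhη, hae⟩ := hkey (δ / 3) η hδ3 hη
      have hmax := maximal_ineq hτ hhi hh0 hδ3
      refine le_trans (measure_mono_ae ?_) (hmax.trans (ENNReal.ofReal_le_ofReal
        (div_le_div_of_nonneg_right hhη.le hδ3.le)))
      filter_upwards [hae] with ω hω
      intro hbad
      by_contra hgood
      refine hbad ?_
      have hgood' : ∀ n : ℕ, birkhoffSum τ h n ω ≤ δ / 3 * n := by
        intro n
        by_contra hc
        exact hgood ⟨n, not_le.1 hc⟩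
      filter_upwards [eventually_ge_atTop 1, eventually_ge_atTop ⌈C / (δ / 3)⌉₊] with n hn hnC
      have hn' : (0 : ℝ) < n := by exact_mod_cast hn
      have h1 := (div_le_iff₀ hδ3).1 (Nat.ceil_le.1 hnC)
      have h2 := hω n hn
      have h3 := hgood' n
      rw [div_le_iff₀ hn']
      nlinarith
    refine le_antisymm (ENNReal.le_of_forall_pos_le_add fun e he _ => ?_) zero_le
    have h1 := hle ((e : ℝ) * (δ / 3)) (by positivity)
    rw [mul_div_cancel_right₀ _ hδ3.ne', ENNReal.ofReal_coe_nnreal] at h1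
    simpa using h1
  have hconv : ∀ᵐ ω ∂μ, Tendsto (fun n : ℕ => f n ω / n) atTop (nhds (F ω)) := by
    have hall : ∀ᵐ ω ∂μ, ∀ m : ℕ, ∀ᶠ n : ℕ in atTop, f n ω / n ≤ F ω + 1 / ((m : ℝ) + 1) :=
      ae_all_iff.2 fun m => hup _ (by positivity)
    filter_upwards [hlow, hall] with ω h1 h2
    rw [tendsto_order]
    constructor
    · intro a ha
      filter_upwards [h1 (F ω - a) (by linarith)] with n hn
      linarith
    · intro a ha
      obtain ⟨m, hm⟩ := exists_nat_one_div_lt (sub_pos.2 ha)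
      filter_upwards [h2 m] with n hn
      linarith
  refine ⟨F, hF, hconv, ?_⟩
  have hdi : ∀ n : ℕ, Integrable (fun ω => f n ω / n) μ := fun n => (hint n).div_const _
  have hpi : ∀ n : ℕ, Integrable (fun ω => max 0 (F ω - f n ω / n)) μ := fun n =>
    (integrable_zero _ _ _).sup (hF.sub (hdi n))
  have hlim : Tendsto (fun n : ℕ => ∫ ω, max 0 (F ω - f n ω / n) ∂μ) atTop (nhds 0) := by
    rw [show nhds (0 : ℝ) = nhds (∫ _ : Ω, (0 : ℝ) ∂μ) by rw [integral_zero]]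
    refine tendsto_integral_of_dominated_convergence F
      (fun n => (hpi n).aestronglyMeasurable) hF ?_ ?_
    · refine fun n => Eventually.of_forall fun ω => ?_
      rw [Real.norm_of_nonneg (le_max_left _ _)]
      exact max_le (hF0 ω) (by linarith [div_nonneg (hpos n ω) (n.cast_nonneg (α := ℝ))])
    · filter_upwards [hconv] with ω hω
      have := (tendsto_const_nhds (x := (0 : ℝ))).max ((tendsto_const_nhds (x := F ω)).sub hω)
      simpa using this
  have heq : ∀ n : ℕ, ∫ ω, |f n ω / n - F ω| ∂μ
      = 2 * ∫ ω, max 0 (F ω - f n ω / n) ∂μ + (∫ ω, f n ω ∂μ) / n - ∫ ω, F ω ∂μ := by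
    intro n
    have hsum : Integrable (fun ω => 2 * max 0 (F ω - f n ω / n) + f n ω / n) μ :=
      ((hpi n).const_mul 2).add (hdi n)
    rw [← integral_div, ← integral_const_mul, ← integral_add ((hpi n).const_mul 2) (hdi n),
      ← integral_sub hsum hF]
    refine integral_congr_ae (Eventually.of_forall fun ω => ?_)
    dsimp only
    rcases le_total (f n ω / n) (F ω) with h | h
    · rw [max_eq_right (by linarith), abs_of_nonpos (by linarith)]; ring
    · rw [max_eq_left (by linarith), abs_of_nonneg (by linarith)]; ring
  rw [tendsto_order]
  constructor
  · intro a ha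
    filter_upwards with n
    exact lt_of_lt_of_le ha (integral_nonneg fun ω => abs_nonneg _)
  · intro a ha
    have ha5 : 0 < a / 5 := by positivity
    obtain ⟨C, h, hC, hhi, hh0, hhη, hae⟩ := hkey (a / 5) (a / 5) ha5 ha5
    filter_upwards [hlim.eventually_lt_const ha5, eventually_ge_atTop 1,
      eventually_ge_atTop ⌈C / (a / 5)⌉₊] with n hn1 hn hnC
    have hn' : (0 : ℝ) < n := by exact_mod_cast hn
    have h1 := (div_le_iff₀ ha5).1 (Nat.ceil_le.1 hnC)
    have hbi : ∀ k ∈ Finset.range n, Integrable (fun ω => h (τ^[k] ω)) μ := fun k _ =>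
      integrable_comp_mp (hτ.iterate k) hhi
    have hbI : Integrable (birkhoffSum τ h n) μ := integrable_finsetSum _ hbi
    have hb : ∫ ω, birkhoffSum τ h n ω ∂μ = n * ∫ ω, h ω ∂μ := by
      simp only [birkhoffSum]
      rw [integral_finsetSum _ hbi, Finset.sum_congr rfl
        (fun k _ => integral_comp_mp (hτ.iterate k) hhi)]
      simp
    have hi1 : Integrable (fun ω => (n : ℝ) * (F ω + a / 5)) μ :=
      (hF.add (integrable_const _)).const_mul _
    have hi2 : Integrable (fun ω => (n : ℝ) * (F ω + a / 5) + C) μ := hi1.add (integrable_const _)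
    have h2 : ∫ ω, f n ω ∂μ ≤ ∫ ω, ((n : ℝ) * (F ω + a / 5) + C + birkhoffSum τ h n ω) ∂μ := by
      refine integral_mono_ae (hint n) (hi2.add hbI) ?_
      filter_upwards [hae] with ω hω using hω n hn
    rw [integral_add hi2 hbI, integral_add hi1 (integrable_const _), integral_const_mul,
      integral_add hF (integrable_const _), hb] at h2
    simp only [integral_const, probReal_univ, one_smul] at h2
    rw [heq n]
    have h3 : (∫ ω, f n ω ∂μ) / n < ∫ ω, F ω ∂μ + 3 * (a / 5) := by
      rw [div_lt_iff₀ hn']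
      nlinarith
    linarith
end
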